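/- arXiv:2502.20612 — 7 statements merged into one kernel-verified Lean document; each statement's English description precedes it below -/
import Mathlib

section
/- Let n be a positive integer, let α ∈ (0,1), and let r₁ ≥ r₂ ≥ ... ≥ rₙ be real numbers in [−1,1] listed in nonincreasing order. Define φ(ν) = αν + (1/n)·∑_{i=1}^n max(r_i − ν, 0) for ν ∈ ℝ, and let k = ⌈αn⌉. Then the k-th largest value s_k = r_k is a minimizer of φ over the interval [−1,1]; that is, for every ν ∈ [−1,1], φ(r_k) ≤ φ(ν). -/
/-- The size of an upper set of indices for the level `s` gives a subgradient at `s` of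
`ν ↦ ∑ i ∈ S, max (r i - ν) 0`. -/
theorem Finset.sum_max_sub_zero_add_le {ι : Type*} [DecidableEq ι] {S T : Finset ι} (hT : T ⊆ S)
    {r : ι → ℝ} {s : ℝ} (hge : ∀ i ∈ T, s ≤ r i) (hle : ∀ i ∈ S \ T, r i ≤ s) (ν : ℝ) :
    ∑ i ∈ S, max (r i - s) 0 + T.card * (s - ν) ≤ ∑ i ∈ S, max (r i - ν) 0 := by
  rw [← Finset.sum_sdiff hT, ← Finset.sum_sdiff hT, add_assoc, ← nsmul_eq_mul,
    ← Finset.sum_const, ← Finset.sum_add_distrib]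
  refine add_le_add (Finset.sum_le_sum fun i hi => ?_) (Finset.sum_le_sum fun i hi => ?_)
  · rw [max_eq_right (sub_nonpos.2 (hle i hi))]
    exact le_max_right _ _
  · rw [max_eq_left (sub_nonneg.2 (hge i hi)), sub_add_sub_cancel]
    exact le_max_left _ _

/-- For a nonincreasing sequence `r 1 ≥ ... ≥ r n` of values in `[-1,1]`,
`α ∈ (0,1)`, `φ ν = α ν + (1/n) ∑ max (r i - ν) 0` and `k = ⌈α n⌉`, the value `r k`
minimizes `φ` over `[-1,1]`. -/
theorem stmt_0 (n : ℕ) (hn : 0 < n) (α : ℝ) (hα : α ∈ Set.Ioo (0 : ℝ) 1)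
    (r : ℕ → ℝ) (hrange : ∀ i ∈ Finset.Icc 1 n, r i ∈ Set.Icc (-1 : ℝ) 1)
    (hmono : ∀ i j, 1 ≤ i → i ≤ j → j ≤ n → r j ≤ r i)
    (φ : ℝ → ℝ)
    (hφ : ∀ ν, φ ν = α * ν + (1 / n) * ∑ i ∈ Finset.Icc 1 n, max (r i - ν) 0)
    (k : ℕ) (hk : k = ⌈α * n⌉₊) :
    ∀ ν ∈ Set.Icc (-1 : ℝ) 1, φ (r k) ≤ φ ν := by
  intro ν _
  have hn' : (0 : ℝ) < n := Nat.cast_pos.2 hn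
  have hαn : 0 < α * n := mul_pos hα.1 hn'
  have hk1 : 1 ≤ k := hk ▸ Nat.one_le_ceil_iff.2 hαn
  have hkn : k ≤ n := hk ▸ Nat.ceil_le.2 (mul_le_of_le_one_left hn'.le hα.2.le)
  have hαk : α * n ≤ k := hk ▸ Nat.le_ceil _
  have hkα : (k : ℝ) < α * n + 1 := hk ▸ Nat.ceil_lt_add_one hαn.le
  have subgradient (m : ℕ) (hm : m ≤ k) (hm' : k ≤ m + 1) :
      ∑ i ∈ Finset.Icc 1 n, max (r i - r k) 0 + m * (r k - ν) ≤
        ∑ i ∈ Finset.Icc 1 n, max (r i - ν) 0 := by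
    have h := Finset.sum_max_sub_zero_add_le (S := Finset.Icc 1 n) (T := Finset.Icc 1 m)
      (r := r) (s := r k) (Finset.Icc_subset_Icc_right (hm.trans hkn))
      (fun i hi => by
        rw [Finset.mem_Icc] at hi
        exact hmono i k hi.1 (hi.2.trans hm) hkn)
      (fun i hi => by
        simp only [Finset.mem_sdiff, Finset.mem_Icc] at hi
        exact hmono k i hk1 (by omega) hi.1.2) ν
    simpa using h
  have key : ∑ i ∈ Finset.Icc 1 n, max (r i - r k) 0 + α * n * (r k - ν) ≤
      ∑ i ∈ Finset.Icc 1 n, max (r i - ν) 0 := by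
    rcases le_total ν (r k) with h | h
    · have := subgradient k le_rfl (Nat.le_succ k)
      nlinarith
    · have := subgradient (k - 1) (Nat.sub_le k 1) (by omega)
      rw [Nat.cast_sub hk1, Nat.cast_one] at this
      nlinarith
  have hdiv := mul_le_mul_of_nonneg_left key (one_div_pos.2 hn').le
  have hcancel : 1 / (n : ℝ) * (α * n * (r k - ν)) = α * (r k - ν) := by
    field_simp
  rw [mul_add, hcancel] at hdiv
  rw [hφ, hφ]
  linarith
end

section
/- Let n be a positive integer, let α ∈ (0,1), and let r₁ ≥ r₂ ≥ ... ≥ rₙ be real numbers listed in nonincreasing order. Define φ(ν) = αν + (1/n)·∑_{i=1}^n max(r_i − ν, 0). Suppose αn is an integer and set k = αn with k < n. Then every ν in the closed interval [r_{k+1}, r_k] is a global minimizer of φ over ℝ: for every such ν and every x ∈ ℝ, φ(ν) ≤ φ(x). -/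
/-- If `α n` is an integer equal to `k` with `k < n`, then every point of
the interval `[r (k+1), r k]` is a global minimizer of the quantile objective `φ`. -/
theorem stmt_2 (n : ℕ) (hn : 0 < n) (α : ℝ) (hα : α ∈ Set.Ioo (0 : ℝ) 1)
    (r : ℕ → ℝ) (hmono : ∀ i j, 1 ≤ i → i ≤ j → j ≤ n → r j ≤ r i)
    (φ : ℝ → ℝ)
    (hφ : ∀ ν, φ ν = α * ν + (1 / n) * ∑ i ∈ Finset.Icc 1 n, max (r i - ν) 0)
    (k : ℕ) (hk : (k : ℝ) = α * n) (hkn : k < n) :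
    ∀ ν ∈ Set.Icc (r (k + 1)) (r k), ∀ x : ℝ, φ ν ≤ φ x := by
  rintro ν ⟨hν₁, hν₂⟩ x
  have hn' : (0 : ℝ) < n := by exact_mod_cast hn
  have hk1 : 1 ≤ k := by
    have : (0 : ℝ) < k := hk ▸ mul_pos hα.1 hn'
    exact_mod_cast this
  have hterm : ∀ i ∈ Finset.Icc 1 n,
      max (r i - ν) 0 + (if i ≤ k then ν - x else 0) ≤ max (r i - x) 0 := by
    intro i hi
    obtain ⟨hi1, hin⟩ := Finset.mem_Icc.mp hi
    split_ifs with hik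
    · have h := hmono i k hi1 hik hkn.le
      rw [max_eq_left (by linarith)]
      exact le_max_of_le_left (by linarith)
    · have h := hmono (k + 1) i (by omega) (by omega) hin
      rw [max_eq_right (by linarith), add_zero]
      exact le_max_right _ _
  have hsum := Finset.sum_le_sum hterm
  have hfilter : (Finset.Icc 1 n).filter (· ≤ k) = Finset.Icc 1 k := by
    ext i
    simp only [Finset.mem_filter, Finset.mem_Icc]
    omega
  rw [Finset.sum_add_distrib, ← Finset.sum_filter, hfilter, Finset.sum_const, Nat.card_Icc,
    Nat.add_sub_cancel, nsmul_eq_mul] at hsum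
  have hα' : α = 1 / n * k := by
    rw [hk]
    field_simp
  rw [hφ, hφ, hα', mul_assoc, mul_assoc, ← mul_add, ← mul_add]
  exact mul_le_mul_of_nonneg_left (by linarith) (by positivity)
end

section
/- Let n be a positive integer, let α ∈ (0,1), and let r₁ ≥ r₂ ≥ ... ≥ rₙ be real numbers listed in nonincreasing order. Define φ(ν) = αν + (1/n)·∑_{i=1}^n max(r_i − ν, 0) and k = ⌈αn⌉. If αn is not an integer, then r_k is the UNIQUE global minimizer of φ over ℝ: any ν ∈ ℝ satisfying φ(ν) ≤ φ(x) for all x ∈ ℝ must equal r_k. -/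
/-- Summing a termwise bound that gains `d` on the first `m` of `n` indices. -/
theorem sum_Icc_add_mul_le {n m : ℕ} (hm : m ≤ n) (f g : ℕ → ℝ) (d : ℝ)
    (h : ∀ i ∈ Finset.Icc 1 n, f i + (if i ≤ m then d else 0) ≤ g i) :
    ∑ i ∈ Finset.Icc 1 n, f i + m * d ≤ ∑ i ∈ Finset.Icc 1 n, g i := by
  have hfilter : (Finset.Icc 1 n).filter (· ≤ m) = Finset.Icc 1 m := by
    ext i
    simp only [Finset.mem_filter, Finset.mem_Icc]
    omega
  have hsum := Finset.sum_le_sum h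
  rwa [Finset.sum_add_distrib, ← Finset.sum_filter, hfilter, Finset.sum_const,
    Nat.card_Icc, Nat.add_sub_cancel, nsmul_eq_mul] at hsum

/-- If `α n` is not an integer, then `r k` with `k = ⌈α n⌉` is the unique
global minimizer of the quantile objective `φ` over `ℝ`. -/
theorem stmt_3 (n : ℕ) (hn : 0 < n) (α : ℝ) (hα : α ∈ Set.Ioo (0 : ℝ) 1)
    (r : ℕ → ℝ) (hmono : ∀ i j, 1 ≤ i → i ≤ j → j ≤ n → r j ≤ r i)
    (φ : ℝ → ℝ)
    (hφ : ∀ ν, φ ν = α * ν + (1 / n) * ∑ i ∈ Finset.Icc 1 n, max (r i - ν) 0)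
    (k : ℕ) (hk : k = ⌈α * n⌉₊)
    (hnotint : ∀ m : ℤ, α * n ≠ (m : ℝ)) :
    ∀ ν : ℝ, (∀ x : ℝ, φ ν ≤ φ x) → ν = r k := by
  intro ν hν
  obtain ⟨hα0, hα1⟩ := hα
  have hn' : (0 : ℝ) < n := Nat.cast_pos.mpr hn
  have hpos : 0 < α * n := mul_pos hα0 hn'
  have hk_pos : 0 < k := hk ▸ Nat.ceil_pos.mpr hpos
  have hk_le : k ≤ n := hk ▸ Nat.ceil_le.mpr (by nlinarith)
  have hk_gt : α * n < k :=
    lt_of_le_of_ne (hk ▸ Nat.le_ceil _) (by exact_mod_cast hnotint k)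
  have hk_lt : (k : ℝ) < α * n + 1 := hk ▸ Nat.ceil_lt_add_one hpos.le
  have hmin : α * n * ν + ∑ i ∈ Finset.Icc 1 n, max (r i - ν) 0 ≤
      α * n * r k + ∑ i ∈ Finset.Icc 1 n, max (r i - r k) 0 := by
    have h := mul_le_mul_of_nonneg_left (hν (r k)) hn'.le
    rw [hφ, hφ] at h
    field_simp at h
    linarith
  rcases lt_trichotomy ν (r k) with hlt | heq | hgt
  · have h := sum_Icc_add_mul_le hk_le (fun i => max (r i - r k) 0)
      (fun i => max (r i - ν) 0) (r k - ν) (by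
        intro i hi
        obtain ⟨hi1, hin⟩ := Finset.mem_Icc.mp hi
        split_ifs with hik
        · have := hmono i k hi1 hik hk_le
          rw [max_eq_left (by linarith), max_eq_left (by linarith)]
          linarith
        · rw [add_zero]
          exact max_le_max_right 0 (by linarith))
    nlinarith
  · exact heq
  · have h := sum_Icc_add_mul_le ((Nat.sub_le k 1).trans hk_le)
      (fun i => max (r i - r k) 0) (fun i => max (r i - ν) 0) (r k - ν) (by
        intro i hi
        obtain ⟨hi1, hin⟩ := Finset.mem_Icc.mp hi
        split_ifs with hik
        · have := hmono i k hi1 (by omega) hk_le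
          rw [max_eq_left (by linarith : 0 ≤ r i - r k)]
          exact le_trans (by linarith) (le_max_left _ _)
        · have := hmono k i hk_pos (by omega) hin
          rw [max_eq_right (by linarith : r i - r k ≤ 0), add_zero]
          exact le_max_right _ _)
    rw [Nat.cast_sub hk_pos, Nat.cast_one] at h
    nlinarith
end

section
/- Let n be a positive integer, let α ∈ ℝ, and let r₁, ..., rₙ be real numbers. Define φ(ν) = αν + (1/n)·∑_{i=1}^n max(r_i − ν, 0). For every ν ∈ ℝ, the left derivative of φ at ν exists and equals α − |{i : r_i ≥ ν}|/n; formally, φ has derivative α − |{i : r_i ≥ ν}|/n at ν within the open ray (−∞, ν). -/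
/-- The left derivative of the hinge function `x ↦ max (a - x) 0` at `ν`. -/
theorem hasDerivWithinAt_hinge_Iio (a ν : ℝ) :
    HasDerivWithinAt (fun x => max (a - x) 0) (if ν ≤ a then -1 else 0) (Set.Iio ν) ν := by
  split_ifs with h
  · refine ((hasDerivAt_id ν).const_sub a).hasDerivWithinAt.congr (fun x hx => ?_) ?_
    · exact max_eq_left (sub_nonneg.2 ((Set.mem_Iio.1 hx).le.trans h))
    · exact max_eq_left (sub_nonneg.2 h)
  · refine ((hasDerivAt_const ν (0 : ℝ)).congr_of_eventuallyEq ?_).hasDerivWithinAt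
    filter_upwards [lt_mem_nhds (not_le.1 h)] with x hx
    exact max_eq_right (sub_nonpos.2 hx.le)

/-- The left derivative of the quantile objective at any `ν` exists and
equals `α - |{i : r i ≥ ν}| / n`. -/
theorem stmt_6 (n : ℕ) (hn : 0 < n) (α : ℝ) (r : ℕ → ℝ)
    (φ : ℝ → ℝ)
    (hφ : ∀ ν, φ ν = α * ν + (1 / n) * ∑ i ∈ Finset.Icc 1 n, max (r i - ν) 0) :
    ∀ ν : ℝ,
      HasDerivWithinAt φ
        (α - (((Finset.Icc 1 n).filter fun i => ν ≤ r i).card : ℝ) / n)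
        (Set.Iio ν) ν := by
  intro ν
  rw [funext hφ]
  have hsum := HasDerivWithinAt.fun_sum (u := Finset.Icc 1 n)
    fun i _ => hasDerivWithinAt_hinge_Iio (r i) ν
  have hlin := ((hasDerivAt_id ν).const_mul α).hasDerivWithinAt (s := Set.Iio ν)
  refine (hlin.add (hsum.const_mul (1 / (n : ℝ)))).congr_deriv ?_
  rw [← Finset.sum_filter, Finset.sum_const, nsmul_eq_mul]
  ring
end

section
/- Let n be a positive integer, let α ∈ ℝ, and let r₁, ..., rₙ be real numbers. Define φ(ν) = αν + (1/n)·∑_{i=1}^n max(r_i − ν, 0). Fix λ ∈ ℝ and let g ∈ ℝ satisfy α − |{i : r_i ≥ λ}|/n ≤ g ≤ α − |{i : r_i > λ}|/n. Then g is a subgradient of φ at λ: for every x ∈ ℝ, φ(x) ≥ φ(λ) + g·(x − λ). -/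
/-- Counting the indices with `r i > lam` gives a subgradient of `∑ max (r i - ·) 0` at `lam`. -/
theorem sum_max_sub_sub_card_lt_mul_le {ι : Type*} (s : Finset ι) (r : ι → ℝ) (lam x : ℝ) :
    ∑ i ∈ s, max (r i - lam) 0 - ((s.filter fun i => lam < r i).card : ℝ) * (x - lam)
      ≤ ∑ i ∈ s, max (r i - x) 0 := by
  rw [Finset.card_filter, Nat.cast_sum, Finset.sum_mul, ← Finset.sum_sub_distrib]
  refine Finset.sum_le_sum fun i _ => ?_
  split_ifs with h
  · rw [max_eq_left (by linarith)]
    push_cast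
    linarith [le_max_left (r i - x) 0]
  · rw [max_eq_right (by linarith)]
    simp

/-- Counting the indices with `r i ≥ lam` gives a subgradient of `∑ max (r i - ·) 0` at `lam`. -/
theorem sum_max_sub_sub_card_le_mul_le {ι : Type*} (s : Finset ι) (r : ι → ℝ) (lam x : ℝ) :
    ∑ i ∈ s, max (r i - lam) 0 - ((s.filter fun i => lam ≤ r i).card : ℝ) * (x - lam)
      ≤ ∑ i ∈ s, max (r i - x) 0 := by
  rw [Finset.card_filter, Nat.cast_sum, Finset.sum_mul, ← Finset.sum_sub_distrib]
  refine Finset.sum_le_sum fun i _ => ?_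
  split_ifs with h
  · rw [max_eq_left (by linarith)]
    push_cast
    linarith [le_max_left (r i - x) 0]
  · rw [max_eq_right (by linarith)]
    simp

/-- Any `g` with `α - |{i : r i ≥ lam}|/n ≤ g ≤ α - |{i : r i > lam}|/n`
is a subgradient of the quantile objective `φ` at `lam`. -/
theorem stmt_9 (n : ℕ) (hn : 0 < n) (α : ℝ) (r : ℕ → ℝ)
    (φ : ℝ → ℝ)
    (hφ : ∀ ν, φ ν = α * ν + (1 / n) * ∑ i ∈ Finset.Icc 1 n, max (r i - ν) 0)
    (lam g : ℝ)
    (hg₁ : α - (((Finset.Icc 1 n).filter fun i => lam ≤ r i).card : ℝ) / n ≤ g)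
    (hg₂ : g ≤ α - (((Finset.Icc 1 n).filter fun i => lam < r i).card : ℝ) / n) :
    ∀ x : ℝ, φ x ≥ φ lam + g * (x - lam) := by
  intro x
  have hn' : (0 : ℝ) < n := Nat.cast_pos.mpr hn
  rw [hφ x, hφ lam]
  rcases le_total lam x with h | h
  · have hsum := mul_le_mul_of_nonneg_left
      (sum_max_sub_sub_card_lt_mul_le (Finset.Icc 1 n) r lam x) (one_div_pos.mpr hn').le
    have hslope := mul_le_mul_of_nonneg_right hg₂ (sub_nonneg.mpr h)
    rw [div_eq_mul_one_div] at hslope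
    linarith
  · have hsum := mul_le_mul_of_nonneg_left
      (sum_max_sub_sub_card_le_mul_le (Finset.Icc 1 n) r lam x) (one_div_pos.mpr hn').le
    have hslope := mul_le_mul_of_nonpos_right hg₁ (sub_nonpos.mpr h)
    rw [div_eq_mul_one_div] at hslope
    linarith
end

section
/- Let n be a positive integer, let α ∈ (0,1), and let r₁ ≥ r₂ ≥ ... ≥ rₙ be real numbers listed in nonincreasing order. Define φ(ν) = αν + (1/n)·∑_{i=1}^n max(r_i − ν, 0) and k = ⌈αn⌉. Then the minimum value of φ over ℝ equals φ(r_k) = α·r_k + (1/n)·∑_{i=1}^{k} (r_i − r_k); equivalently, inf_{ν∈ℝ} φ(ν) = (1/n)·∑_{i=1}^{k} r_i − r_k·(k/n − α). -/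
/-- Any initial sum of the differences `r i - x` is at most the full hinge sum at `x`. -/
lemma sum_Icc_sub_le_sum_max (r : ℕ → ℝ) {m n : ℕ} (hmn : m ≤ n) (x : ℝ) :
    ∑ i ∈ Finset.Icc 1 m, r i - m * x ≤ ∑ i ∈ Finset.Icc 1 n, max (r i - x) 0 := by
  calc ∑ i ∈ Finset.Icc 1 m, r i - m * x = ∑ i ∈ Finset.Icc 1 m, (r i - x) := by
        simp [Finset.sum_sub_distrib]
    _ ≤ ∑ i ∈ Finset.Icc 1 m, max (r i - x) 0 :=
        Finset.sum_le_sum fun i _ => le_max_left _ _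
    _ ≤ ∑ i ∈ Finset.Icc 1 n, max (r i - x) 0 :=
        Finset.sum_le_sum_of_subset_of_nonneg (Finset.Icc_subset_Icc_right hmn)
          fun i _ _ => le_max_right _ _

/-- For a nonincreasing sequence, only the first `k` terms contribute to the hinge sum at `r k`. -/
lemma sum_max_sub_eq_sum_Icc {n k : ℕ} (r : ℕ → ℝ)
    (hmono : ∀ i j, 1 ≤ i → i ≤ j → j ≤ n → r j ≤ r i) (hk : 1 ≤ k) (hkn : k ≤ n) :
    ∑ i ∈ Finset.Icc 1 n, max (r i - r k) 0 = ∑ i ∈ Finset.Icc 1 k, (r i - r k) := by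
  rw [← Finset.sum_subset (Finset.Icc_subset_Icc_right hkn)]
  · refine Finset.sum_congr rfl fun i hi => max_eq_left ?_
    obtain ⟨h1, h2⟩ := Finset.mem_Icc.mp hi
    exact sub_nonneg.mpr (hmono i k h1 h2 hkn)
  · intro i hi hik
    simp only [Finset.mem_Icc] at hi hik
    exact max_eq_right (sub_nonpos.mpr (hmono k i hk (by omega) hi.2))

/-- For a nonincreasing sequence and `k = ⌈α n⌉`, the minimum value of the
quantile objective `φ` over `ℝ` is attained at `r k` and equals
`α r_k + (1/n) ∑_{i=1}^k (r i - r k) = (1/n) ∑_{i=1}^k r i - r k (k/n - α)`. -/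
theorem stmt_10 (n : ℕ) (hn : 0 < n) (α : ℝ) (hα : α ∈ Set.Ioo (0 : ℝ) 1)
    (r : ℕ → ℝ) (hmono : ∀ i j, 1 ≤ i → i ≤ j → j ≤ n → r j ≤ r i)
    (φ : ℝ → ℝ)
    (hφ : ∀ ν, φ ν = α * ν + (1 / n) * ∑ i ∈ Finset.Icc 1 n, max (r i - ν) 0)
    (k : ℕ) (hk : k = ⌈α * n⌉₊) :
    (∀ x : ℝ, φ (r k) ≤ φ x) ∧
      φ (r k) = α * r k + (1 / n) * ∑ i ∈ Finset.Icc 1 k, (r i - r k) ∧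
      φ (r k) = (1 / n) * ∑ i ∈ Finset.Icc 1 k, r i - r k * ((k : ℝ) / n - α) := by
  have hn' : (0 : ℝ) < n := by exact_mod_cast hn
  have hpos : 0 < α * n := mul_pos hα.1 hn'
  have hk1 : 1 ≤ k := hk ▸ Nat.ceil_pos.mpr hpos
  have hkn : k ≤ n := hk ▸ Nat.ceil_le.mpr (by nlinarith [hα.2])
  have hle : α * n ≤ k := hk ▸ Nat.le_ceil _
  have hlt : (k : ℝ) < α * n + 1 := hk ▸ Nat.ceil_lt_add_one hpos.le
  have hsum := sum_max_sub_eq_sum_Icc r hmono hk1 hkn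
  have hsum' : ∑ i ∈ Finset.Icc 1 k, (r i - r k) = ∑ i ∈ Finset.Icc 1 k, r i - k * r k := by
    simp [Finset.sum_sub_distrib]
  refine ⟨fun x => ?_, by rw [hφ, hsum], ?_⟩
  · suffices h : α * n * r k + (∑ i ∈ Finset.Icc 1 k, r i - k * r k) ≤
        α * n * x + ∑ i ∈ Finset.Icc 1 n, max (r i - x) 0 by
      have hscale : ∀ y S : ℝ, α * y + 1 / n * S = 1 / n * (α * n * y + S) := by
        intro y S
        field_simp
      rw [hφ, hφ, hsum, hsum', hscale, hscale]
      gcongr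
    rcases le_total x (r k) with hx | hx
    · nlinarith [sum_Icc_sub_le_sum_max r hkn x]
    · obtain ⟨j, rfl⟩ : ∃ j, k = j + 1 := ⟨k - 1, by omega⟩
      have hj := sum_Icc_sub_le_sum_max r (show j ≤ n by omega) x
      rw [Finset.sum_Icc_succ_top (by omega)]
      push_cast at hlt ⊢
      nlinarith
  · rw [hφ, hsum, hsum']
    field_simp
    ring
end

section
/- Let n be a positive integer, let α ∈ (0,1), and let r₁ ≥ r₂ ≥ ... ≥ rₙ be real numbers listed in nonincreasing order with k = ⌈αn⌉ and k < n. Define φ(ν) = αν + (1/n)·∑_{i=1}^n max(r_i − ν, 0). Then every global minimizer ν of φ over ℝ satisfies r_{k+1} ≤ ν ≤ r_k; that is, the set of minimizers is contained in the closed interval between the (k+1)-th and the k-th largest values. -/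
/-- The sum over `1, …, n` of the constant `d` on the first `m` indices is `m * d`. -/
lemma sum_Icc_ite_le (n m : ℕ) (hm : m ≤ n) (d : ℝ) :
    ∑ i ∈ Finset.Icc 1 n, (if i ≤ m then d else 0) = m * d := by
  have h : (Finset.Icc 1 n).filter (· ≤ m) = Finset.Icc 1 m := by
    ext i
    simp only [Finset.mem_filter, Finset.mem_Icc]
    omega
  rw [← Finset.sum_filter, h]
  simp

/-- For a nonincreasing sequence, `α ∈ (0,1)`, `k = ⌈α n⌉ < n`, every
global minimizer `ν` of the quantile objective `φ` satisfies `r (k+1) ≤ ν ≤ r k`. -/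
theorem stmt_16 (n : ℕ) (hn : 0 < n) (α : ℝ) (hα : α ∈ Set.Ioo (0 : ℝ) 1)
    (r : ℕ → ℝ) (hmono : ∀ i j, 1 ≤ i → i ≤ j → j ≤ n → r j ≤ r i)
    (φ : ℝ → ℝ)
    (hφ : ∀ ν, φ ν = α * ν + (1 / n) * ∑ i ∈ Finset.Icc 1 n, max (r i - ν) 0)
    (k : ℕ) (hk : k = ⌈α * n⌉₊) (hkn : k < n) :
    ∀ ν : ℝ, (∀ x : ℝ, φ ν ≤ φ x) → r (k + 1) ≤ ν ∧ ν ≤ r k := by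
  intro ν hν
  have hn' : (0 : ℝ) < n := by exact_mod_cast hn
  have hαn : 0 < α * n := mul_pos hα.1 hn'
  have hk1 : 1 ≤ k := hk ▸ Nat.ceil_pos.2 hαn
  have hle : α * n ≤ k := hk ▸ Nat.le_ceil _
  have hlt : (k : ℝ) < α * n + 1 := hk ▸ Nat.ceil_lt_add_one hαn.le
  have hmin : ∀ x, α * n * ν + ∑ i ∈ Finset.Icc 1 n, max (r i - ν) 0
      ≤ α * n * x + ∑ i ∈ Finset.Icc 1 n, max (r i - x) 0 := by
    intro x
    have h := mul_le_mul_of_nonneg_left (hν x) hn'.le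
    rw [hφ, hφ] at h
    field_simp at h
    linarith
  constructor
  · by_contra! hc
    have hsum : ∑ i ∈ Finset.Icc 1 n, (max (r i - r (k + 1)) 0
        + if i ≤ k + 1 then r (k + 1) - ν else 0) ≤ ∑ i ∈ Finset.Icc 1 n, max (r i - ν) 0 := by
      refine Finset.sum_le_sum fun i hi => ?_
      rw [Finset.mem_Icc] at hi
      split_ifs with h
      · have := hmono i (k + 1) hi.1 h hkn
        rw [max_eq_left (by linarith), max_eq_left (by linarith)]
        linarith
      · rw [add_zero]
        gcongr
    rw [Finset.sum_add_distrib, sum_Icc_ite_le n (k + 1) hkn] at hsum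
    push_cast at hsum
    nlinarith [hmin (r (k + 1))]
  · by_contra! hc
    have hsum : ∑ i ∈ Finset.Icc 1 n, max (r i - r k) 0 ≤ ∑ i ∈ Finset.Icc 1 n,
        (max (r i - ν) 0 + if i ≤ k - 1 then ν - r k else 0) := by
      refine Finset.sum_le_sum fun i hi => ?_
      rw [Finset.mem_Icc] at hi
      split_ifs with h
      · refine max_le ?_ ?_
        · linarith [le_max_left (r i - ν) 0]
        · linarith [le_max_right (r i - ν) 0]
      · have := hmono k i hk1 (by omega) hi.2
        rw [max_eq_right (by linarith), add_zero]
        exact le_max_right _ _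
    rw [Finset.sum_add_distrib, sum_Icc_ite_le n (k - 1) (by omega)] at hsum
    push_cast [hk1] at hsum
    nlinarith [hmin (r k)]
end
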